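/- arXiv:2012.11897 — 2 statements merged into one kernel-verified Lean document; each statement's English description precedes it below -/
import Mathlib

section
/- For every z ∈ F_q*, one has the identity of complex numbers q·(N_3(z) − q²) = −cq + 3·(χ(z) + χ̄(z))·q²; in particular, N_3(z) = q² + 6q − c if z is a cube and N_3(z) = q² − 3q − c otherwise. -/
/-- `Ncube F s z` is the number of `s`-tuples `(x₁, …, x_s) ∈ F^s` with
`x₁³ + ⋯ + x_s³ = z`. -/
noncomputable def Ncube (F : Type) [Field F] [Fintype F] (s : ℕ) (z : F) : ℕ :=
  Nat.card {x : Fin s → F // ∑ i, x i ^ 3 = z}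

/-- A prime `p ≡ 2 (mod 3)` is inert in the Eisenstein integers. -/
theorem Nat.Prime.dvd_of_dvd_sq_add_twentyseven_mul_sq {p : ℕ} (hp : p.Prime) (h2 : p ≠ 2)
    (h3 : p % 3 = 2) {a b : ℤ} (h : (p : ℤ) ∣ a ^ 2 + 27 * b ^ 2) :
    (p : ℤ) ∣ a ∧ (p : ℤ) ∣ b := by
  have : Fact p.Prime := ⟨hp⟩
  have three : (3 : ZMod p) ≠ 0 := by
    intro h0
    have : p ∣ 3 := (ZMod.natCast_eq_zero_iff 3 p).mp (by exact_mod_cast h0)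
    have := (Nat.prime_dvd_prime_iff_eq hp Nat.prime_three).mp this
    omega
  have two : (2 : ZMod p) ≠ 0 := by
    intro h0
    have : p ∣ 2 := (ZMod.natCast_eq_zero_iff 2 p).mp (by exact_mod_cast h0)
    exact h2 ((Nat.prime_dvd_prime_iff_eq hp Nat.prime_two).mp this)
  have hab : (a : ZMod p) ^ 2 + 27 * (b : ZMod p) ^ 2 = 0 := by
    have := (ZMod.intCast_zmod_eq_zero_iff_dvd _ p).mpr h
    exact_mod_cast this
  have hb : (b : ZMod p) = 0 := by
    by_contra hb
    set t : ZMod p := a / (3 * b) with ht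
    have hat : (a : ZMod p) = t * (3 * b) := (div_mul_cancel₀ _ (mul_ne_zero three hb)).symm
    have ht3 : t ^ 2 = -3 := by
      have h9 : (9 : ZMod p) * (b : ZMod p) ^ 2 ≠ 0 := by
        have : (9 : ZMod p) = 3 ^ 2 := by norm_num
        rw [this]; positivity
      apply mul_left_cancel₀ h9
      rw [hat] at hab
      linear_combination hab
    set w : ZMod p := (t - 1) / 2 with hw
    have htw : t = 2 * w + 1 := by rw [hw, mul_div_cancel₀ _ two]; ring
    have hw1 : w ^ 2 + w + 1 = 0 := by
      have h4 : (2 : ZMod p) ^ 2 ≠ 0 := pow_ne_zero 2 two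
      apply mul_left_cancel₀ h4
      rw [htw] at ht3
      linear_combination ht3
    have hw3 : w ^ 3 = 1 := by linear_combination (w - 1) * hw1
    have hw0 : w ≠ 0 := by
      intro h0
      rw [h0] at hw1
      simp at hw1
    have hfer := ZMod.pow_card_sub_one_eq_one hw0
    have hexp : p - 1 = 3 * (p / 3) + 1 := by omega
    rw [hexp, pow_succ, pow_mul, hw3, one_pow, one_mul] at hfer
    apply three
    rw [hfer] at hw1
    linear_combination hw1
  have ha : (a : ZMod p) = 0 := by
    rw [hb] at hab
    simpa using hab
  exact ⟨(ZMod.intCast_zmod_eq_zero_iff_dvd _ p).mp ha,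
    (ZMod.intCast_zmod_eq_zero_iff_dvd _ p).mp hb⟩

theorem Int.eq_zero_of_four_eq_sq_add_twentyseven_mul_sq {a b : ℤ}
    (h : 4 = a ^ 2 + 27 * b ^ 2) : b = 0 := by
  by_contra hb
  have : 0 < b ^ 2 := by positivity
  nlinarith [sq_nonneg a]

theorem Nat.Prime.eq_zero_of_four_mul_pow_eq {p : ℕ} (hp : p.Prime) (h3 : p % 3 = 2) (m : ℕ)
    {a b : ℤ} (h : 4 * (p : ℤ) ^ (2 * m) = a ^ 2 + 27 * b ^ 2) : b = 0 := by
  induction m generalizing a b with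
  | zero => exact Int.eq_zero_of_four_eq_sq_add_twentyseven_mul_sq (by simpa using h)
  | succ m ih =>
    have hp0 : (p : ℤ) ≠ 0 := by exact_mod_cast hp.ne_zero
    have hdvd : (p : ℤ) ∣ a ∧ (p : ℤ) ∣ b := by
      by_cases h2 : p = 2
      · subst h2
        have h16 : (a ^ 2 + 27 * b ^ 2) % 8 = 0 := by
          rw [← h, mul_add, pow_add]
          push_cast
          omega
        have ha : a % 8 = 0 ∨ a % 8 = 1 ∨ a % 8 = 2 ∨ a % 8 = 3 ∨ a % 8 = 4 ∨ a % 8 = 5 ∨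
          a % 8 = 6 ∨ a % 8 = 7 := by omega
        have hb : b % 8 = 0 ∨ b % 8 = 1 ∨ b % 8 = 2 ∨ b % 8 = 3 ∨ b % 8 = 4 ∨ b % 8 = 5 ∨
          b % 8 = 6 ∨ b % 8 = 7 := by omega
        rcases ha with ha | ha | ha | ha | ha | ha | ha | ha <;>
        rcases hb with hb | hb | hb | hb | hb | hb | hb | hb <;>
        first
        | (constructor <;> push_cast <;> omega)
        | (exfalso; simp [pow_two, Int.add_emod, Int.mul_emod, ha, hb] at h16)
      · exact hp.dvd_of_dvd_sq_add_twentyseven_mul_sq h2 h3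
          (h ▸ Dvd.dvd.mul_left (dvd_pow_self _ (by omega)) _)
    obtain ⟨⟨a, rfl⟩, ⟨b, rfl⟩⟩ := hdvd
    rw [ih (a := a) (b := b), mul_zero]
    apply mul_left_cancel₀ (pow_ne_zero 2 hp0)
    linear_combination h

/-- The integer `c` in `4q = c² + 27d²` is unique under the usual normalisation. -/
theorem eq_of_four_mul_prime_pow_eq {p k : ℕ} (hp : p.Prime) (hq : p ^ k % 3 = 1) {c d c' d' : ℤ}
    (h : 4 * (p : ℤ) ^ k = c ^ 2 + 27 * d ^ 2) (h' : 4 * (p : ℤ) ^ k = c' ^ 2 + 27 * d' ^ 2)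
    (hc : c % 3 = 1) (hc' : c' % 3 = 1) (hcp : p % 3 = 1 → IsCoprime c (p : ℤ))
    (hcp' : p % 3 = 1 → ¬ (p : ℤ) ∣ c') : c = c' := by
  suffices hs : c ^ 2 = c' ^ 2 by
    rcases sq_eq_sq_iff_eq_or_eq_neg.mp hs with h | h <;> omega
  have hp' : Prime (p : ℤ) := Nat.prime_iff_prime_int.mp hp
  have hq0 : (0 : ℤ) < (p : ℤ) ^ k := by have := hp.pos; positivity
  have hp3 : p % 3 = 0 ∨ p % 3 = 1 ∨ p % 3 = 2 := by omega
  rcases hp3 with h3 | h3 | h3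
  · rcases Nat.eq_zero_or_pos k with rfl | hk
    · rw [pow_zero, mul_one] at h h'
      rw [Int.eq_zero_of_four_eq_sq_add_twentyseven_mul_sq h] at h
      rw [Int.eq_zero_of_four_eq_sq_add_twentyseven_mul_sq h'] at h'
      linarith
    · have : p ^ k % 3 = 0 := by rw [Nat.pow_mod, h3, Nat.zero_pow hk]
      omega
  · specialize hcp h3
    specialize hcp' h3
    have hpc : ¬ (p : ℤ) ∣ c := fun hd => hp'.not_isUnit (hcp.isUnit_of_dvd' hd dvd_rfl)
    have hp2 : ¬ (p : ℤ) ∣ 2 := by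
      intro hd
      have : p ∣ 2 := by exact_mod_cast hd
      have := (Nat.prime_dvd_prime_iff_eq hp Nat.prime_two).mp this
      omega
    have hprod : (p : ℤ) ^ k ∣ (c * d' - c' * d) * (c * d' + c' * d) :=
      ⟨4 * (d' ^ 2 - d ^ 2), by linear_combination d ^ 2 * h' - d' ^ 2 * h⟩
    have vanish : ∀ {x y : ℤ}, 16 * ((p : ℤ) ^ k) ^ 2 = y ^ 2 + 27 * x ^ 2 → (p : ℤ) ^ k ∣ x →
        x = 0 := by
      rintro _ y hy ⟨e, rfl⟩
      by_contra hne
      have he : e ≠ 0 := fun h0 => hne (by rw [h0, mul_zero])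
      have : 1 ≤ e ^ 2 := Int.add_one_le_of_lt (sq_pos_of_ne_zero he)
      nlinarith [sq_nonneg y, mul_le_mul_of_nonneg_left this (sq_nonneg ((p : ℤ) ^ k)),
        pow_pos hq0 2]
    have key : (c * d' - c' * d) * (c * d' + c' * d) = 0 := by
      by_cases hX : (p : ℤ) ∣ c * d' - c' * d
      · by_cases hY : (p : ℤ) ∣ c * d' + c' * d
        · rcases ne_or_eq k 0 with hk | rfl
          · exfalso
            have h1 : (p : ℤ) ∣ 2 * (c * d') := by
              have := dvd_add hX hY
              ring_nf at this ⊢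
              exact this
            have h2 := ((hp'.dvd_or_dvd h1).resolve_left hp2 |> hp'.dvd_or_dvd).resolve_left hpc
            apply hcp'
            apply hp'.dvd_of_dvd_pow (n := 2)
            have h3 : (p : ℤ) ∣ 4 * (p : ℤ) ^ k := (dvd_pow_self _ hk).mul_left _
            have : c' ^ 2 = 4 * (p : ℤ) ^ k - d' * (27 * d') := by linear_combination -h'
            rw [this]
            exact dvd_sub h3 (h2.mul_right _)
          · rw [vanish (x := c * d' - c' * d) (y := c * c' + 27 * d * d') ?_ (by simp), zero_mul]
            linear_combination 4 * h + (c ^ 2 + 27 * d ^ 2) * h'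
        · have hcop : IsCoprime ((p : ℤ) ^ k) (c * d' + c' * d) :=
            ((hp'.coprime_iff_not_dvd).mpr hY).pow_left
          rw [vanish (x := c * d' - c' * d) (y := c * c' + 27 * d * d') ?_
            (hcop.dvd_of_dvd_mul_right hprod), zero_mul]
          linear_combination 4 * (p : ℤ) ^ k * h + (c ^ 2 + 27 * d ^ 2) * h'
      · have hcop : IsCoprime ((p : ℤ) ^ k) (c * d' - c' * d) :=
          ((hp'.coprime_iff_not_dvd).mpr hX).pow_left
        rw [vanish (x := c * d' + c' * d) (y := c * c' - 27 * d * d') ?_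
          (hcop.dvd_of_dvd_mul_left hprod), mul_zero]
        linear_combination 4 * (p : ℤ) ^ k * h + (c ^ 2 + 27 * d ^ 2) * h'
    have hd : d' ^ 2 = d ^ 2 := by
      apply mul_left_cancel₀ (mul_ne_zero four_ne_zero hq0.ne')
      linear_combination key + d' ^ 2 * h - d ^ 2 * h'
    linear_combination h' - h - 27 * -hd
  · have hk : k % 2 = 0 := by
      by_contra hk
      have hk2 : k = 2 * (k / 2) + 1 := by omega
      rw [hk2, pow_succ, pow_mul, Nat.mul_mod, Nat.pow_mod, Nat.pow_mod p, h3] at hq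
      simp at hq
    obtain ⟨m, rfl⟩ : ∃ m, k = 2 * m := ⟨k / 2, by omega⟩
    rw [hp.eq_zero_of_four_mul_pow_eq h3 m h] at h
    rw [hp.eq_zero_of_four_mul_pow_eq h3 m h'] at h'
    linarith

theorem Nat.Prime.not_dvd_choose_of_three_mul_add_one_eq_pow {p : ℕ} (hp : p.Prime)
    (h3 : p % 3 = 1) {k n : ℕ} (hn : 3 * n + 1 = p ^ k) : ¬ p ∣ (2 * n).choose n := by
  have : Fact p.Prime := ⟨hp⟩
  induction k generalizing n with
  | zero =>
    obtain rfl : n = 0 := by simpa using hn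
    simpa using hp.one_lt.ne'
  | succ k ih =>
    obtain ⟨m, hm⟩ : ∃ m, p = 3 * m + 1 := ⟨p / 3, by omega⟩
    obtain ⟨l, hl⟩ : ∃ l, 3 * l + 1 = p ^ k := by
      have : p ^ k % 3 = 1 := by simp [Nat.pow_mod, h3]
      exact ⟨p ^ k / 3, by omega⟩
    have hnl : n = m + p * l := by
      rw [pow_succ, ← hl] at hn
      have : 3 * n = 3 * (m + p * l) := by
        nlinarith
      omega
    have h2n : 2 * n = 2 * m + p * (2 * l) := by rw [hnl]; ring
    rw [(Choose.choose_modEq_choose_mod_mul_choose_div_nat (p := p)).dvd_iff dvd_rfl, h2n, hnl,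
      Nat.add_mul_mod_self_left, Nat.add_mul_mod_self_left, Nat.add_mul_div_left _ _ hp.pos,
      Nat.add_mul_div_left _ _ hp.pos, Nat.mod_eq_of_lt (by omega : 2 * m < p),
      Nat.mod_eq_of_lt (by omega : m < p), Nat.div_eq_of_lt (by omega : 2 * m < p),
      Nat.div_eq_of_lt (by omega : m < p), zero_add, zero_add, hp.dvd_mul]
    rintro (h | h)
    · have h1 : p ∣ (2 * m).factorial :=
        h.trans ⟨m.factorial * (2 * m - m).factorial, by
          rw [← mul_assoc, Nat.choose_mul_factorial_mul_factorial (by omega)]⟩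
      have := hp.dvd_factorial.mp h1
      omega
    · exact ih hl h

section CubicCharacter

variable {F : Type*} [Field F] [Fintype F] {g : Fˣ}

theorem exists_pow_eq_of_forall_mem_zpowers (hg : ∀ x : Fˣ, x ∈ Subgroup.zpowers g) {y : F}
    (hy : y ≠ 0) : ∃ m : ℕ, (g : F) ^ m = y := by
  obtain ⟨m, hm⟩ := (mem_powers_iff_mem_zpowers (x := g)).mpr (hg (Units.mk0 y hy))
  exact ⟨m, by simpa using congrArg Units.val hm⟩

theorem orderOf_val_eq_of_forall_mem_zpowers (hg : ∀ x : Fˣ, x ∈ Subgroup.zpowers g) {n : ℕ}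
    (hcard : Fintype.card F = 3 * n + 1) : orderOf (g : F) = 3 * n := by
  rw [orderOf_units, orderOf_eq_card_of_forall_mem_zpowers hg, Nat.card_units,
    Nat.card_eq_fintype_card, hcard, Nat.add_sub_cancel]

/-- A multiplicative map of order dividing `3` only depends on the cubic residue symbol. -/
theorem MonoidWithZeroHom.apply_eq_sum_ite {R : Type*} [CommRing R] [DecidableEq F]
    (hg : ∀ x : Fˣ, x ∈ Subgroup.zpowers g) {n : ℕ} (hcard : Fintype.card F = 3 * n + 1)
    (f : F →*₀ R) (hf : f g ^ 3 = 1) (y : F) :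
    f y = ∑ i ∈ Finset.range 3, if y ^ n = (g : F) ^ (n * i) then f g ^ i else 0 := by
  have hn : n ≠ 0 := by
    rintro rfl
    have := Fintype.one_lt_card (α := F)
    omega
  rcases eq_or_ne y 0 with rfl | hy
  · rw [map_zero, Finset.sum_eq_zero]
    intro i _
    rw [if_neg]
    rw [zero_pow hn]
    exact (pow_ne_zero _ g.ne_zero).symm
  · obtain ⟨m, rfl⟩ := exists_pow_eq_of_forall_mem_zpowers hg hy
    have hiff : ∀ i < 3, (((g : F) ^ m) ^ n = (g : F) ^ (n * i) ↔ m % 3 = i) := by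
      intro i hi
      have hinj : Function.Injective (Units.val : Fˣ → F) := Units.val_injective
      rw [← pow_mul, ← Units.val_pow_eq_pow_val, ← Units.val_pow_eq_pow_val, hinj.eq_iff,
        pow_eq_pow_iff_modEq, ← orderOf_units, orderOf_val_eq_of_forall_mem_zpowers hg hcard,
        mul_comm m, mul_comm 3]
      rw [Nat.ModEq, Nat.mul_mod_mul_left, Nat.mul_mod_mul_left, Nat.mul_right_inj hn,
        Nat.mod_eq_of_lt hi]
    rw [Finset.sum_congr rfl fun i hi => if_congr (hiff i (Finset.mem_range.mp hi)) rfl rfl,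
      Finset.sum_ite_eq, if_pos (Finset.mem_range.mpr (Nat.mod_lt _ (by norm_num))), map_pow]
    exact pow_eq_pow_mod m hf

theorem MonoidWithZeroHom.sum_apply_sub_sq {R : Type*} [CommRing R] [DecidableEq F]
    (hg : ∀ x : Fˣ, x ∈ Subgroup.zpowers g) {n : ℕ} (hcard : Fintype.card F = 3 * n + 1)
    (f : F →*₀ R) (hf : f g ^ 3 = 1) :
    ∑ x, f (x * (1 - x)) = ∑ i ∈ Finset.range 3,
      (Finset.univ.filter fun x : F => (x * (1 - x)) ^ n = (g : F) ^ (n * i)).card * f g ^ i := by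
  rw [Finset.sum_congr rfl fun x _ => f.apply_eq_sum_ite hg hcard hf (x * (1 - x)),
    Finset.sum_comm]
  refine Finset.sum_congr rfl fun i _ => ?_
  rw [← Finset.sum_filter, Finset.sum_const, nsmul_eq_mul]

theorem sum_mul_one_sub_pow (N : ℕ) :
    ∑ x : F, (x * (1 - x)) ^ N =
      ∑ j ∈ Finset.range (N + 1), (-1) ^ j * (N.choose j : F) * ∑ x : F, x ^ (N + j) := by
  have h : ∀ x : F, (x * (1 - x)) ^ N =
      ∑ j ∈ Finset.range (N + 1), (-1) ^ j * (N.choose j : F) * x ^ (N + j) := by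
    intro x
    rw [mul_pow, sub_eq_neg_add, add_pow, Finset.mul_sum]
    refine Finset.sum_congr rfl fun j _ => ?_
    rw [neg_pow x, one_pow, pow_add]
    ring
  simp_rw [h, Finset.mul_sum]
  exact Finset.sum_comm

theorem sum_mul_one_sub_pow_eq_zero {n : ℕ} (hn : n ≠ 0) (hcard : Fintype.card F = 3 * n + 1) :
    ∑ x : F, (x * (1 - x)) ^ n = 0 := by
  rw [sum_mul_one_sub_pow]
  refine Finset.sum_eq_zero fun j hj => ?_
  have := Finset.mem_range.mp hj
  rw [FiniteField.sum_pow_lt_card_sub_one, mul_zero]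
  omega

theorem sum_mul_one_sub_pow_two_mul {n : ℕ} (hn : n ≠ 0) (hcard : Fintype.card F = 3 * n + 1) :
    ∑ x : F, (x * (1 - x)) ^ (2 * n) = -((-1) ^ n * ((2 * n).choose n : F)) := by
  classical
  have hsum : ∀ i : ℕ, i ≠ 0 → ∑ x : F, x ^ i = if 3 * n ∣ i then -1 else 0 := by
    intro i hi
    have h := FiniteField.sum_pow_units F i
    rw [hcard, Nat.add_sub_cancel] at h
    rw [← h, ← Finset.sum_subset (Finset.subset_univ (Finset.univ.map ⟨_, Units.val_injective⟩)),
      Finset.sum_map]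
    · rfl
    · intro x _ hx
      have : x = 0 := by
        by_contra hx0
        exact hx (Finset.mem_map.mpr ⟨Units.mk0 x hx0, Finset.mem_univ _, rfl⟩)
      rw [this, zero_pow hi]
  rw [sum_mul_one_sub_pow, Finset.sum_eq_single n]
  · rw [hsum _ (by omega), if_pos ⟨1, by ring⟩, mul_neg_one]
  · intro j hj hjn
    have := Finset.mem_range.mp hj
    rw [hsum _ (by omega), if_neg, mul_zero]
    rintro ⟨e, he⟩
    have h1 : e < 2 := by
      by_contra h
      have : 3 * n * 2 ≤ 3 * n * e := Nat.mul_le_mul_left _ (by omega)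
      omega
    interval_cases e <;> omega
  · intro h
    exact absurd (Finset.mem_range.mpr (by omega)) h

theorem jacobiSum_self_eq_sum (χ : MulChar F ℂ) :
    jacobiSum χ χ = ∑ x, χ (x * (1 - x)) := by
  simp only [jacobiSum, map_mul]

theorem not_dvd_of_jacobiSum_add_jacobiSum_inv_eq {p k : ℕ} (hp : p.Prime) (h3 : p % 3 = 1)
    (hF : Fintype.card F = p ^ k) (hg : ∀ x : Fˣ, x ∈ Subgroup.zpowers g) {χ : MulChar F ℂ}
    (hχ : χ g ^ 2 + χ g + 1 = 0) {c : ℤ}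
    (hc : jacobiSum χ χ + jacobiSum χ⁻¹ χ⁻¹ = c) : ¬ (p : ℤ) ∣ c := by
  classical
  have : Fact p.Prime := ⟨hp⟩
  obtain ⟨n, hcard⟩ : ∃ n, Fintype.card F = 3 * n + 1 := by
    have : p ^ k % 3 = 1 := by simp [Nat.pow_mod, h3]
    exact ⟨p ^ k / 3, by omega⟩
  have hn : n ≠ 0 := by
    rintro rfl
    have := Fintype.one_lt_card (α := F)
    omega
  have : CharP F p := charP_of_card_eq_prime_pow hF
  have hχ3 : χ g ^ 3 = 1 := by linear_combination (χ g - 1) * hχ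
  have hinv : χ⁻¹ g = χ g ^ 2 := by
    rw [MulChar.inv_apply_eq_inv']
    exact inv_eq_of_mul_eq_one_right (by linear_combination hχ3)
  have hJ := χ.toMonoidWithZeroHom.sum_apply_sub_sq hg hcard hχ3
  have hJ' := χ⁻¹.toMonoidWithZeroHom.sum_apply_sub_sq hg hcard
    (show χ⁻¹ g ^ 3 = 1 by rw [hinv]; linear_combination (χ g ^ 3 + 1) * hχ3)
  change ∑ x, χ (x * (1 - x)) = ∑ i ∈ Finset.range 3, _ * χ g ^ i at hJ
  change ∑ x, χ⁻¹ (x * (1 - x)) = ∑ i ∈ Finset.range 3, _ * χ⁻¹ g ^ i at hJ'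
  rw [← jacobiSum_self_eq_sum] at hJ hJ'
  have hord := orderOf_val_eq_of_forall_mem_zpowers hg hcard
  set w : F := (g : F) ^ n with hw
  have hw3 : w ^ 3 = 1 := by rw [hw, ← pow_mul, mul_comm, ← hord, pow_orderOf_eq_one]
  have hw1 : w ≠ 1 := pow_ne_one_of_lt_orderOf hn (by omega)
  have hww : w ^ 2 + w + 1 = 0 := by
    apply mul_left_cancel₀ (sub_ne_zero.mpr hw1)
    linear_combination hw3
  have hP := (powMonoidWithZeroHom (M₀ := F) hn).sum_apply_sub_sq hg hcard hw3
  have hP' := (powMonoidWithZeroHom (M₀ := F) (mul_ne_zero two_ne_zero hn)).sum_apply_sub_sq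
    hg hcard (show ((g : F) ^ (2 * n)) ^ 3 = 1 by
      rw [mul_comm, pow_mul, ← hw]; linear_combination (w ^ 3 + 1) * hw3)
  change ∑ x, (x * (1 - x)) ^ n = ∑ i ∈ Finset.range 3, _ * w ^ i at hP
  change ∑ x, (x * (1 - x)) ^ (2 * n) = ∑ i ∈ Finset.range 3, _ * ((g : F) ^ (2 * n)) ^ i at hP'
  rw [mul_comm 2 n, pow_mul (g : F), ← hw, mul_comm n 2, sum_mul_one_sub_pow_two_mul hn hcard]
    at hP'
  rw [sum_mul_one_sub_pow_eq_zero hn hcard] at hP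
  rw [hinv] at hJ'
  obtain ⟨A, hA⟩ : ∃ A : ℕ → ℕ, ∀ i, (Finset.univ.filter fun x : F =>
    (x * (1 - x)) ^ n = (g : F) ^ (n * i)).card = A i := ⟨_, fun _ => rfl⟩
  simp only [Finset.sum_range_succ, Finset.sum_range_zero, hA] at hJ hJ' hP hP'
  have hcA : c = 2 * A 0 - A 1 - A 2 := by
    have : (c : ℂ) = 2 * A 0 - A 1 - A 2 := by
      rw [← hc, hJ, hJ']
      linear_combination (A 1 + A 2 * (χ g ^ 2 - χ g + 1)) * hχ
    exact_mod_cast this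
  intro hdvd
  have hcF : (c : F) = 0 := (CharP.intCast_eq_zero_iff F p c).mpr hdvd
  have : (c : F) = -((-1) ^ n * ((2 * n).choose n : F)) := by
    rw [hP', hcA]
    push_cast
    linear_combination -hP - (A 1 + A 2 * (w ^ 2 - w + 1)) * hww
  rw [hcF, zero_eq_neg, mul_eq_zero, or_iff_right (pow_ne_zero _ (neg_ne_zero.mpr one_ne_zero)),
    CharP.cast_eq_zero_iff F p] at this
  exact hp.not_dvd_choose_of_three_mul_add_one_eq_pow h3 (hcard.symm.trans hF) this

end CubicCharacter

section CubicGaussSum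

variable {F : Type*} [Field F] {g : Fˣ} {χ : MulChar F ℂ}

theorem MulChar.pow_three_eq_one_of_apply_generator (hg : ∀ x : Fˣ, x ∈ Subgroup.zpowers g)
    (hχ : χ g ^ 2 + χ g + 1 = 0) : χ ^ 3 = 1 := by
  rw [MulChar.eq_iff hg, MulChar.pow_apply_coe, MulChar.one_apply_coe]
  linear_combination (χ g - 1) * hχ

theorem MulChar.ne_one_of_apply_generator (hχ : χ g ^ 2 + χ g + 1 = 0) : χ ≠ 1 := by
  rintro rfl
  rw [MulChar.one_apply_coe] at hχ
  norm_num at hχ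

theorem MulChar.apply_pow_three (h3 : χ ^ 3 = 1) {x : F} (hx : x ≠ 0) : χ (x ^ 3) = 1 := by
  rw [map_pow, ← MulChar.pow_apply' χ three_ne_zero, h3, MulChar.one_apply (Ne.isUnit hx)]

variable [Fintype F]

theorem MulChar.one_add_apply_add_inv_apply (hg : ∀ x : Fˣ, x ∈ Subgroup.zpowers g)
    (hχ : χ g ^ 2 + χ g + 1 = 0) {y : F} (hy : ¬ ∃ x : F, x ^ 3 = y) :
    1 + χ y + χ⁻¹ y = 0 := by
  have hy0 : y ≠ 0 := fun h => hy ⟨0, by rw [h, zero_pow three_ne_zero]⟩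
  have hg3 : χ g ^ 3 = 1 := by linear_combination (χ g - 1) * hχ
  obtain ⟨m, rfl⟩ := exists_pow_eq_of_forall_mem_zpowers hg hy0
  have hinv : χ⁻¹ ((g : F) ^ m) = χ ((g : F) ^ m) ^ 2 := by
    rw [MulChar.inv_apply_eq_inv']
    apply inv_eq_of_mul_eq_one_right
    rw [map_pow, ← pow_succ', ← pow_mul, mul_comm, pow_mul, hg3, one_pow]
  rw [hinv, map_pow, pow_eq_pow_mod m hg3]
  have hm : m % 3 = 0 ∨ m % 3 = 1 ∨ m % 3 = 2 := by omega
  rcases hm with hm | hm | hm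
  · exact absurd ⟨(g : F) ^ (m / 3), by rw [← pow_mul, Nat.div_mul_cancel (by omega)]⟩ hy
  · rw [hm]
    linear_combination hχ
  · rw [hm]
    linear_combination (χ g ^ 2 - χ g + 1) * hχ

theorem card_cube_roots [DecidableEq F] (hg : ∀ x : Fˣ, x ∈ Subgroup.zpowers g)
    (hq : Fintype.card F % 3 = 1) (hχ : χ g ^ 2 + χ g + 1 = 0) (y : F) :
    ((Finset.univ.filter fun x : F => x ^ 3 = y).card : ℂ) =
      1 + χ y + χ⁻¹ y := by
  have h3 := MulChar.pow_three_eq_one_of_apply_generator hg hχ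
  by_cases hy : y = 0
  · have : (Finset.univ.filter fun x : F => x ^ 3 = y) = {0} := by
      ext x
      simp [hy]
    rw [this, hy, MulChar.map_zero, MulChar.map_zero]
    simp
  · obtain ⟨n, hcard⟩ : ∃ n, Fintype.card F = 3 * n + 1 := ⟨Fintype.card F / 3, by omega⟩
    have hprim : IsPrimitiveRoot ((g : F) ^ n) 3 := by
      have := IsPrimitiveRoot.orderOf (g : F)
      rw [orderOf_val_eq_of_forall_mem_zpowers hg hcard] at this
      have hcard' := Fintype.one_lt_card (α := F)
      exact this.pow (by omega) (mul_comm _ _)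
    have hset : (Finset.univ.filter fun x : F => x ^ 3 = y) =
        (Polynomial.nthRoots 3 y).toFinset := by
      ext x
      simp [Polynomial.mem_nthRoots]
    rw [hset, Multiset.toFinset_card_of_nodup (hprim.nthRoots_nodup hy), hprim.card_nthRoots]
    split_ifs with hex
    · obtain ⟨x, rfl⟩ := hex
      have hx : x ≠ 0 := fun h => hy (by rw [h, zero_pow three_ne_zero])
      rw [MulChar.inv_apply_eq_inv', MulChar.apply_pow_three h3 hx]
      norm_num
    · rw [MulChar.one_add_apply_add_inv_apply hg hχ hex, Nat.cast_zero]

theorem sum_addChar_mul_cube (hg : ∀ x : Fˣ, x ∈ Subgroup.zpowers g)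
    (hq : Fintype.card F % 3 = 1) (hχ : χ g ^ 2 + χ g + 1 = 0) {ψ : AddChar F ℂ}
    (hψ : ψ.IsPrimitive) {t : F} (ht : t ≠ 0) :
    ∑ x : F, ψ (t * x ^ 3) = χ⁻¹ t * gaussSum χ ψ + χ t * gaussSum χ⁻¹ ψ := by
  classical
  have hsum : ∑ y : F, ψ (t * y) = 0 := by
    have := AddChar.sum_mulShift t hψ
    rw [if_neg ht, Nat.cast_zero] at this
    rw [← this]
    exact Finset.sum_congr rfl fun y _ => by rw [mul_comm]
  have hgauss : ∀ φ : MulChar F ℂ, ∑ y : F, φ y * ψ (t * y) = φ⁻¹ t * gaussSum φ ψ := fun φ =>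
    gaussSum_mulShift_eq φ ψ (Units.mk0 t ht)
  have hfib : ∑ x : F, ψ (t * x ^ 3) =
      ∑ y : F, ((Finset.univ.filter fun x : F => x ^ 3 = y).card : ℂ) * ψ (t * y) := by
    rw [← Finset.sum_fiberwise' Finset.univ (fun x : F => x ^ 3) (fun y => ψ (t * y))]
    exact Finset.sum_congr rfl fun y _ => by rw [Finset.sum_const, nsmul_eq_mul]
  have hterm : ∀ y : F, ((Finset.univ.filter fun x : F => x ^ 3 = y).card : ℂ) * ψ (t * y) =
      ψ (t * y) + χ y * ψ (t * y) + χ⁻¹ y * ψ (t * y) := by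
    intro y
    rw [card_cube_roots hg hq hχ]
    ring
  rw [hfib, Finset.sum_congr rfl fun y _ => hterm y, Finset.sum_add_distrib,
    Finset.sum_add_distrib, hsum, hgauss, hgauss, inv_inv, zero_add]

theorem gaussSum_mul_gaussSum_inv_of_pow_three (h3 : χ ^ 3 = 1) (h1 : χ ≠ 1) {ψ : AddChar F ℂ}
    (hψ : ψ.IsPrimitive) : gaussSum χ ψ * gaussSum χ⁻¹ ψ = Fintype.card F := by
  have hneg : χ⁻¹ (-1) = 1 := by
    have h := MulChar.apply_pow_three h3 (neg_ne_zero.mpr (one_ne_zero (α := F)))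
    rw [Odd.neg_one_pow (by decide)] at h
    rw [MulChar.inv_apply_eq_inv', h, inv_one]
  rw [← mul_gaussSum_inv_eq_gaussSum χ⁻¹ ψ, hneg, one_mul, gaussSum_mul_gaussSum_eq_card h1 hψ]

theorem gaussSum_pow_three (h3 : χ ^ 3 = 1) (h1 : χ ≠ 1) {ψ : AddChar F ℂ}
    (hψ : ψ.IsPrimitive) : gaussSum χ ψ ^ 3 = Fintype.card F * jacobiSum χ χ := by
  have hord : orderOf χ = 3 := orderOf_eq_prime h3 h1
  have h := gaussSum_pow_eq_prod_jacobiSum (χ := χ) (by omega) hψ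
  have hneg := MulChar.apply_pow_three h3 (neg_ne_zero.mpr (one_ne_zero (α := F)))
  rw [Odd.neg_one_pow (by decide)] at hneg
  rw [hord, hneg] at h
  simpa using h

theorem card_mul_card_sum_three_cubes (hg : ∀ x : Fˣ, x ∈ Subgroup.zpowers g)
    (hq : Fintype.card F % 3 = 1) (hχ : χ g ^ 2 + χ g + 1 = 0) {z : F} (hz : z ≠ 0) :
    (Fintype.card F : ℂ) * (Nat.card {x : Fin 3 → F // ∑ i, x i ^ 3 = z} : ℂ) =
      (Fintype.card F : ℂ) ^ 3 - Fintype.card F * (jacobiSum χ χ + jacobiSum χ⁻¹ χ⁻¹) +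
        3 * (Fintype.card F : ℂ) ^ 2 * (χ z + χ⁻¹ z) := by
  classical
  obtain ⟨ψ, hψ⟩ : ∃ ψ : AddChar F ℂ, ψ.IsPrimitive :=
    ⟨_, AddChar.FiniteField.primitiveChar_to_Complex_isPrimitive F⟩
  have h3 := MulChar.pow_three_eq_one_of_apply_generator hg hχ
  have h1 := MulChar.ne_one_of_apply_generator hχ
  have hG := gaussSum_mul_gaussSum_inv_of_pow_three h3 h1 hψ
  have hG3 := gaussSum_pow_three h3 h1 hψ
  have hG3' := gaussSum_pow_three (χ := χ⁻¹) (by rw [inv_pow, h3, inv_one])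
    (inv_ne_one.mpr h1) hψ
  have hneg := MulChar.apply_pow_three h3 (neg_ne_zero.mpr (one_ne_zero (α := F)))
  rw [Odd.neg_one_pow (by decide)] at hneg
  set G := gaussSum χ ψ
  set G' := gaussSum χ⁻¹ ψ
  set q : ℂ := (Fintype.card F : ℂ)
  have hcount : q * (Nat.card {x : Fin 3 → F // ∑ i, x i ^ 3 = z} : ℂ) =
      ∑ t : F, ψ (t * -z) * (∑ x : F, ψ (t * x ^ 3)) ^ 3 := by
    simp_rw [Fintype.sum_pow, Finset.mul_sum]
    rw [Finset.sum_comm, Nat.card_eq_fintype_card, Fintype.card_subtype, mul_comm,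
      ← nsmul_eq_mul, ← Finset.sum_const, Finset.sum_filter]
    refine Finset.sum_congr rfl fun x _ => ?_
    have : ∀ t : F, ψ (t * -z) * ∏ i, ψ (t * x i ^ 3) = ψ (t * (∑ i, x i ^ 3 - z)) := by
      intro t
      rw [Fin.prod_univ_three, Fin.sum_univ_three]
      simp only [← AddChar.map_add_eq_mul]
      ring_nf
    simp_rw [this]
    rw [AddChar.sum_mulShift _ hψ]
    simp only [sub_eq_zero]
    split_ifs <;> simp [q]
  have hz' : -z ≠ 0 := neg_ne_zero.mpr hz
  have hsum : ∑ t ∈ Finset.univ.erase (0 : F), ψ (t * -z) = -1 := by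
    have h := AddChar.sum_mulShift (-z) hψ
    rw [if_neg hz', Nat.cast_zero, ← Finset.add_sum_erase _ _ (Finset.mem_univ (0 : F)),
      zero_mul, AddChar.map_zero_eq_one] at h
    linear_combination h
  have hgauss : ∀ φ : MulChar F ℂ, φ (-1) = 1 →
      ∑ t ∈ Finset.univ.erase (0 : F), φ t * ψ (t * -z) = φ⁻¹ z * gaussSum φ ψ := by
    intro φ hφ
    have h : ∑ y : F, φ y * ψ (-z * y) = φ⁻¹ (-z) * gaussSum φ ψ :=
      gaussSum_mulShift_eq φ ψ (Units.mk0 (-z) hz')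
    rw [← Finset.add_sum_erase _ _ (Finset.mem_univ (0 : F)), MulChar.map_zero, zero_mul,
      zero_add, neg_eq_neg_one_mul, map_mul, MulChar.inv_apply_eq_inv' φ (-1), hφ, inv_one,
      one_mul] at h
    rw [← h]
    exact Finset.sum_congr rfl fun t _ => by ring_nf
  have hterm : ∀ t ∈ Finset.univ.erase (0 : F), ψ (t * -z) * (∑ x : F, ψ (t * x ^ 3)) ^ 3 =
      (G ^ 3 + G' ^ 3) * ψ (t * -z) + 3 * q * G * (χ⁻¹ t * ψ (t * -z)) +
        3 * q * G' * (χ t * ψ (t * -z)) := by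
    intro t ht
    have ht0 := Finset.ne_of_mem_erase ht
    rw [sum_addChar_mul_cube hg hq hχ hψ ht0]
    have hmul : χ t * χ⁻¹ t = 1 := by
      rw [← MulChar.mul_apply, mul_inv_cancel, MulChar.one_apply (Ne.isUnit ht0)]
    have hc : χ t ^ 3 = 1 := by rw [← map_pow, MulChar.apply_pow_three h3 ht0]
    have hc' : χ⁻¹ t ^ 3 = 1 := by
      rw [MulChar.inv_apply_eq_inv', inv_pow, hc, inv_one]
    linear_combination ψ (t * -z) * (G ^ 3 * hc' + G' ^ 3 * hc +
      (3 * G * G' * (χ⁻¹ t * G + χ t * G')) * hmul + 3 * (χ⁻¹ t * G + χ t * G') * hG)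
  rw [hcount, ← Finset.add_sum_erase _ _ (Finset.mem_univ (0 : F)),
    Finset.sum_congr rfl hterm, Finset.sum_add_distrib, Finset.sum_add_distrib,
    ← Finset.mul_sum, ← Finset.mul_sum, ← Finset.mul_sum, hsum, hgauss χ hneg,
    hgauss χ⁻¹ (by rw [MulChar.inv_apply_eq_inv', hneg, inv_one]), inv_inv]
  simp only [zero_mul, AddChar.map_zero_eq_one, Finset.sum_const, Finset.card_univ, nsmul_eq_mul,
    mul_one, one_mul]
  linear_combination -hG3 - hG3' + 3 * q * (χ z + χ⁻¹ z) * hG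

/-- The trace and norm of the Jacobi sum of a cubic character. -/
theorem exists_jacobiSum_add_jacobiSum_inv_eq (hg : ∀ x : Fˣ, x ∈ Subgroup.zpowers g)
    (hq : Fintype.card F % 3 = 1) (hχ : χ g ^ 2 + χ g + 1 = 0) :
    ∃ c d : ℤ, jacobiSum χ χ + jacobiSum χ⁻¹ χ⁻¹ = c ∧ c % 3 = 1 ∧
      4 * (Fintype.card F : ℤ) = c ^ 2 + 27 * d ^ 2 := by
  have h3 := MulChar.pow_three_eq_one_of_apply_generator hg hχ
  have h1 := MulChar.ne_one_of_apply_generator hχ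
  set ω := χ g with hω
  have hω3 : ω ^ 3 = 1 := by linear_combination (ω - 1) * hχ
  have hω1 : ω ≠ 1 := by
    intro h
    rw [h] at hχ
    norm_num at hχ
  have hprim : IsPrimitiveRoot ω 3 := by
    have := IsPrimitiveRoot.orderOf ω
    rwa [orderOf_eq_prime hω3 hω1] at this
  obtain ⟨z, hz, hJ⟩ := exists_jacobiSum_eq_neg_one_add (n := 3) (by norm_num) h3 h3
    ((Nat.modEq_iff_dvd' Fintype.card_pos).mp hq.symm) hprim
  obtain ⟨s, t, rfl⟩ : ∃ s t : ℤ, z = s + t * ω := by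
    clear hJ
    induction hz using Algebra.adjoin_induction with
    | mem x hx =>
      rw [Set.mem_singleton_iff] at hx
      exact ⟨0, 1, by simp [hx]⟩
    | algebraMap r => exact ⟨r, 0, by simp⟩
    | add x y _ _ hx hy =>
      obtain ⟨s, t, rfl⟩ := hx
      obtain ⟨s', t', rfl⟩ := hy
      exact ⟨s + s', t + t', by push_cast; ring⟩
    | mul x y _ _ hx hy =>
      obtain ⟨s, t, rfl⟩ := hx
      obtain ⟨s', t', rfl⟩ := hy
      refine ⟨s * s' - t * t', s * t' + t * s' - t * t', ?_⟩
      push_cast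
      linear_combination (t * t' : ℂ) * hχ
  have hconj : starRingEnd ℂ ω = ω ^ 2 := by
    have h := MulChar.star_apply' χ g
    rw [MulChar.inv_apply_eq_inv', ← hω] at h
    exact h.trans (inv_eq_of_mul_eq_one_right (by linear_combination hω3))
  have hinv : χ⁻¹ = χ.ringHomComp (starRingEnd ℂ) := by
    ext a
    exact (MulChar.star_apply' χ a).symm
  have hJ₁ : jacobiSum χ χ = -1 + 3 * t + 3 * (t - s) * ω := by
    linear_combination hJ + (s + t * ω - 3 * t) * hχ
  have hJ₂ : jacobiSum χ⁻¹ χ⁻¹ = -1 + 3 * t + 3 * (t - s) * ω ^ 2 := by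
    rw [hinv, jacobiSum_ringHomComp, hJ₁]
    have h3' : starRingEnd ℂ 3 = 3 := map_ofNat _ 3
    simp [hconj, h3']
  have hsq : χ * χ ≠ 1 := by
    intro h
    rw [pow_succ, sq, h, one_mul] at h3
    exact h1 h3
  have hnorm : jacobiSum χ χ * jacobiSum χ⁻¹ χ⁻¹ = Fintype.card F := by
    refine jacobiSum_mul_jacobiSum_inv ?_ h1 h1 hsq
    rw [ringChar.eq_zero]
    exact (CharP.ringChar_ne_zero_of_finite F).symm
  have htr : jacobiSum χ χ + jacobiSum χ⁻¹ χ⁻¹ = ((-2 + 3 * s + 3 * t : ℤ) : ℂ) := by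
    rw [hJ₁, hJ₂]
    push_cast
    linear_combination (3 * (t - s) : ℂ) * hχ
  refine ⟨-2 + 3 * s + 3 * t, t - s, htr, by omega, ?_⟩
  have : 4 * (Fintype.card F : ℂ) = (-2 + 3 * s + 3 * t) ^ 2 + 27 * (t - s) ^ 2 := by
    rw [← hnorm, hJ₁, hJ₂]
    linear_combination (12 * (-1 + 3 * t) * (t - s) + 36 * (t - s) ^ 2 * (ω - 1) : ℂ) * hχ
  exact_mod_cast this

end CubicGaussSum

/-- For every `z ∈ F_q*`, `q·(N₃(z) - q²) = -cq + 3(χ(z)+χ̄(z))q²`; in particular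
`N₃(z) = q²+6q-c` if `z` is a cube and `N₃(z) = q²-3q-c` otherwise. -/
theorem qN3_identity
    (p k q : ℕ) [Fact p.Prime] (hk : 0 < k) (hq : q = p ^ k) (hq3 : q % 3 = 1)
    (F : Type) [Field F] [Fintype F] (hF : Fintype.card F = q)
    (g : Fˣ) (hg : ∀ x : Fˣ, x ∈ Subgroup.zpowers g)
    (χ : MulChar F ℂ) (hχ : χ (g : F) = (-1 + (Real.sqrt 3 : ℂ) * Complex.I) / 2)
    (c d : ℤ) (h4q : 4 * (q : ℤ) = c ^ 2 + 27 * d ^ 2) (hc3 : c % 3 = 1)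
    (hd : 0 ≤ d) (hcp : p % 3 = 1 → IsCoprime c (p : ℤ))
    (z : F) (hz : z ≠ 0) :
    (q : ℂ) * ((Ncube F 3 z : ℂ) - (q : ℂ) ^ 2)
      = -(c : ℂ) * (q : ℂ)
          + 3 * (χ z + (χ.ringHomComp (starRingEnd ℂ)) z) * (q : ℂ) ^ 2
    ∧ ((∃ x : F, x ^ 3 = z) → (Ncube F 3 z : ℤ) = (q : ℤ) ^ 2 + 6 * (q : ℤ) - c)
    ∧ (¬ (∃ x : F, x ^ 3 = z) → (Ncube F 3 z : ℤ) = (q : ℤ) ^ 2 - 3 * (q : ℤ) - c) := by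
  have hp : p.Prime := Fact.out
  have hω : χ g ^ 2 + χ g + 1 = 0 := by
    have hs : ((Real.sqrt 3 : ℝ) : ℂ) ^ 2 = 3 := by
      rw [← Complex.ofReal_pow, Real.sq_sqrt (by norm_num)]
      norm_num
    rw [hχ]
    linear_combination (1 / 4 : ℂ) * Complex.I ^ 2 * hs + (3 / 4 : ℂ) * Complex.I_sq
  have hq3' : Fintype.card F % 3 = 1 := by rw [hF, hq3]
  obtain ⟨c', d', htr, hc3', h4q'⟩ := exists_jacobiSum_add_jacobiSum_inv_eq hg hq3' hω
  obtain rfl : c = c' := by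
    rw [hF] at h4q'
    subst hq
    push_cast at h4q h4q'
    exact eq_of_four_mul_prime_pow_eq hp hq3 h4q h4q' hc3 hc3' hcp fun h3 =>
      not_dvd_of_jacobiSum_add_jacobiSum_inv_eq hp h3 hF hg hω htr
  have hq0 : (q : ℂ) ≠ 0 := by
    rw [← hF]
    exact_mod_cast Fintype.card_ne_zero
  have hN : (q : ℂ) * Ncube F 3 z = _ := hF ▸ card_mul_card_sum_three_cubes hg hq3' hω hz
  rw [htr] at hN
  have hinv : (χ.ringHomComp (starRingEnd ℂ)) z = χ⁻¹ z := MulChar.star_apply' χ z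
  refine ⟨?_, fun hcube => ?_, fun hcube => ?_⟩
  · rw [hinv]
    linear_combination hN
  · obtain ⟨x, rfl⟩ := hcube
    have hx : x ≠ 0 := fun h => hz (by rw [h, zero_pow three_ne_zero])
    rw [MulChar.inv_apply_eq_inv', MulChar.apply_pow_three
      (MulChar.pow_three_eq_one_of_apply_generator hg hω) hx] at hN
    have : (Ncube F 3 (x ^ 3) : ℂ) = (q : ℂ) ^ 2 + 6 * q - c := by
      apply mul_left_cancel₀ hq0
      rw [hN]
      ring
    exact_mod_cast this
  · have h := MulChar.one_add_apply_add_inv_apply hg hω hcube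
    have : (Ncube F 3 z : ℂ) = (q : ℂ) ^ 2 - 3 * q - c := by
      apply mul_left_cancel₀ hq0
      rw [hN]
      linear_combination 3 * (q : ℂ) ^ 2 * h
    exact_mod_cast this
end

section
/- For every z ∈ F_q* and every integer s ≥ 4, setting u_s(z) = N_s(z) − q^{s-1}, one has the linear recurrence u_s(z) = 3q·u_{s-2}(z) + qc·u_{s-3}(z). -/
section

open Finset

/-- Norms from the Eisenstein integers at an inert prime. -/
theorem eisenstein_norm_inert {p : ℕ} [hp : Fact p.Prime] (hp3 : p % 3 = 2) (k : ℕ) (a b : ℤ)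
    (hb : 3 ∣ b) (h : a ^ 2 - a * b + b ^ 2 = (p : ℤ) ^ k) : b = 0 := by
  induction k using Nat.strong_induction_on generalizing a b with
  | _ k ih =>
  have hp' : Prime (p : ℤ) := Nat.prime_iff_prime_int.mp hp.out
  rcases Nat.eq_zero_or_pos k with rfl | hk
  · obtain ⟨e, rfl⟩ := hb
    simp only [pow_zero] at h
    have : e ^ 2 < 1 := by nlinarith [sq_nonneg (2 * a - 3 * e)]
    have : e = 0 := pow_eq_zero_iff two_ne_zero |>.mp (by linarith [sq_nonneg e])
    simp [this]
  have hpb : (p : ℤ) ∣ b := by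
    by_contra hpb
    have hb0 : (b : ZMod p) ≠ 0 := by
      rwa [Ne, ZMod.intCast_zmod_eq_zero_iff_dvd]
    have h0 : (a : ZMod p) ^ 2 - a * b + b ^ 2 = 0 := by
      have := congrArg (Int.cast : ℤ → ZMod p) h
      push_cast at this
      rw [this, CharP.cast_eq_zero, zero_pow hk.ne']
    obtain ⟨x, hx⟩ : ∃ x : ZMod p, x ^ 2 + x + 1 = 0 := by
      refine ⟨-(a / b), ?_⟩
      field_simp
      linear_combination h0
    have hx3 : x ^ 3 = 1 := by linear_combination (x - 1) * hx
    have hx0 : x ≠ 0 := by rintro rfl; simp at hx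
    have hxp : x ^ (p - 1) = 1 := ZMod.pow_card_sub_one_eq_one hx0
    have hx1 : x = 1 := by
      have hpm : p - 1 = 3 * (p / 3) + 1 := by omega
      rwa [hpm, pow_succ, pow_mul, hx3, one_pow, one_mul] at hxp
    subst hx1
    have h3 : ((3 : ℕ) : ZMod p) = 0 := by push_cast; linear_combination hx
    rw [ZMod.natCast_eq_zero_iff] at h3
    have := (Nat.prime_dvd_prime_iff_eq hp.out Nat.prime_three).mp h3
    omega
  have hpa : (p : ℤ) ∣ a := by
    have : (p : ℤ) ∣ a ^ 2 := by
      have e : a ^ 2 = (p : ℤ) ^ k + b * (a - b) := by linear_combination h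
      rw [e]
      exact dvd_add (dvd_pow_self _ hk.ne') (hpb.mul_right _)
    exact hp'.dvd_of_dvd_pow this
  obtain ⟨a, rfl⟩ := hpa
  obtain ⟨b, rfl⟩ := hpb
  have hp0 : (p : ℤ) ≠ 0 := hp'.ne_zero
  have hb' : (3 : ℤ) ∣ b := by
    rcases Int.prime_three.dvd_or_dvd hb with h3 | h3
    · omega
    · exact h3
  have hk2 : 2 ≤ k := by
    by_contra hk2
    obtain rfl : k = 1 := by omega
    refine hp'.not_isUnit (isUnit_of_dvd_one ⟨a ^ 2 - a * b + b ^ 2, mul_left_cancel₀ hp0 ?_⟩)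
    linear_combination -h
  obtain ⟨j, rfl⟩ := Nat.exists_eq_add_of_le hk2
  rw [ih j (by omega) a b hb' (mul_left_cancel₀ (pow_ne_zero 2 hp0)
    (by rw [← pow_add]; linear_combination h)), mul_zero]

theorem cubic_parameters_unique_of_inert {p : ℕ} [hp : Fact p.Prime] (hp3 : p % 3 = 2) (k : ℕ)
    {c d : ℤ} (h : 4 * (p : ℤ) ^ k = c ^ 2 + 27 * d ^ 2) : d = 0 := by
  have hpar : (2 : ℤ) ∣ c + 3 * d := by
    have h2 : (2 : ℤ) ∣ (c + 3 * d) ^ 2 :=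
      ⟨2 * (p : ℤ) ^ k + 3 * c * d - 9 * d ^ 2, by linear_combination -h⟩
    exact Int.prime_two.dvd_of_dvd_pow h2
  obtain ⟨a, ha⟩ := hpar
  have := eisenstein_norm_inert hp3 k a (3 * d) ⟨d, rfl⟩ (by
    have hc : c = 2 * a - 3 * d := by linear_combination ha
    subst hc
    linarith)
  omega

theorem eq_of_sq_eq_sq_of_mod_three {c c' : ℤ} (h : c ^ 2 = c' ^ 2) (hc : c % 3 = 1)
    (hc' : c' % 3 = 1) : c = c' := by
  rcases sq_eq_sq_iff_eq_or_eq_neg.mp h with h | h <;> omega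

theorem cubic_parameters_unique_of_split {p : ℕ} [hp : Fact p.Prime] (hp2 : p ≠ 2) (k : ℕ)
    {c d c' d' : ℤ} (h : 4 * (p : ℤ) ^ k = c ^ 2 + 27 * d ^ 2)
    (h' : 4 * (p : ℤ) ^ k = c' ^ 2 + 27 * d' ^ 2) (hc : IsCoprime c p) (hc' : IsCoprime c' p)
    (hk : 0 < k) : c ^ 2 = c' ^ 2 := by
  have hp' : Prime (p : ℤ) := Nat.prime_iff_prime_int.mp hp.out
  have hq0 : (0 : ℤ) < (p : ℤ) ^ k := pow_pos (by exact_mod_cast hp.out.pos) k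
  set q : ℤ := (p : ℤ) ^ k with hq
  have key : ∀ e : ℤ, e ^ 2 = d ^ 2 → q ∣ c * d' - c' * e → c ^ 2 = c' ^ 2 := by
    rintro e he ⟨t, ht⟩
    have h1 : 16 * q ^ 2 = (c * c' + 27 * e * d') ^ 2 + 27 * (q * t) ^ 2 := by
      rw [← ht]
      have h2 : 4 * q = c ^ 2 + 27 * e ^ 2 := by rw [he, h]
      calc 16 * q ^ 2 = (4 * q) * (4 * q) := by ring
        _ = (c ^ 2 + 27 * e ^ 2) * (c' ^ 2 + 27 * d' ^ 2) := by rw [← h2, ← h']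
        _ = _ := by ring
    have ht0 : t ^ 2 < 1 := by
      by_contra hlt
      push Not at hlt
      nlinarith [sq_nonneg (c * c' + 27 * e * d'),
        mul_le_mul_of_nonneg_left hlt (sq_nonneg q), pow_pos hq0 2]
    have ht1 : t = 0 := pow_eq_zero_iff two_ne_zero |>.mp (by linarith [sq_nonneg t])
    rw [ht1, mul_zero, sub_eq_zero] at ht
    have h3 : c ^ 2 * d' ^ 2 = c' ^ 2 * d ^ 2 := by rw [← he, ← mul_pow, ht, mul_pow]
    have h4 : (4 * q) * (d' ^ 2 - d ^ 2) = 0 := by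
      linear_combination h3 + d' ^ 2 * h - d ^ 2 * h'
    have h5 := (mul_eq_zero.mp h4).resolve_left (by positivity)
    linarith
  have hmul : q ∣ (c * d' - c' * d) * (c * d' - c' * -d) :=
    ⟨4 * (d' ^ 2 - d ^ 2), by linear_combination d ^ 2 * h' - d' ^ 2 * h⟩
  by_cases h1 : (p : ℤ) ∣ c * d' - c' * d
  · have h2 : ¬ (p : ℤ) ∣ c * d' - c' * -d := by
      intro h2
      have h3 : (p : ℤ) ∣ 2 * (c * d') := by
        have := dvd_add h1 h2
        ring_nf at this ⊢
        exact this
      have hpc : ¬ (p : ℤ) ∣ c := fun hd => hp'.not_isUnit (hc.isUnit_of_dvd' hd dvd_rfl)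
      have hpc' : ¬ (p : ℤ) ∣ c' := fun hd => hp'.not_isUnit (hc'.isUnit_of_dvd' hd dvd_rfl)
      rcases hp'.dvd_or_dvd h3 with h3 | h3
      · have : p ∣ 2 := by exact_mod_cast h3
        exact hp2 ((Nat.prime_dvd_prime_iff_eq hp.out Nat.prime_two).mp this)
      · have hd' := (hp'.dvd_or_dvd h3).resolve_left hpc
        apply hpc'
        apply hp'.dvd_of_dvd_pow (n := 2)
        have e : c' ^ 2 = 4 * q - d' * (27 * d') := by linear_combination -h'
        rw [e]
        exact dvd_sub ((dvd_pow_self _ hk.ne').mul_left _) (hd'.mul_right _)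
    have hcop : IsCoprime q (c * d' - c' * -d) :=
      ((Prime.coprime_iff_not_dvd hp').mpr h2).pow_left
    exact key d rfl (hcop.dvd_of_dvd_mul_right hmul)
  · have hcop : IsCoprime q (c * d' - c' * d) :=
      ((Prime.coprime_iff_not_dvd hp').mpr h1).pow_left
    exact key (-d) (by ring) (hcop.dvd_of_dvd_mul_left hmul)

theorem not_dvd_choose_third {p : ℕ} [hp : Fact p.Prime] (hp3 : p % 3 = 1) (k m : ℕ)
    (hm : 3 * m + 1 = p ^ k) : ¬ p ∣ (2 * m).choose m := by
  induction k generalizing m with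
  | zero =>
    obtain rfl : m = 0 := by simpa using hm
    simpa using hp.out.one_lt.ne'
  | succ k ih =>
    obtain ⟨r, hr⟩ : ∃ r, p = 3 * r + 1 := ⟨p / 3, by omega⟩
    have hr0 : 0 < r := by have := hp.out.one_lt; omega
    obtain ⟨n, hn⟩ : ∃ n, 3 * n + 1 = p ^ k := by
      refine ⟨p ^ k / 3, ?_⟩
      have : p ^ k % 3 = 1 := by rw [Nat.pow_mod, hp3, one_pow, Nat.one_mod]
      omega
    have hmn : m = r + p * n := by
      have : p ^ (k + 1) = 3 * (p * n) + p := by rw [pow_succ, ← hn]; ring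
      omega
    have h2m : 2 * m = 2 * r + p * (2 * n) := by rw [hmn]; ring
    have hl := Choose.choose_modEq_choose_mod_mul_choose_div_nat (p := p) (n := 2 * m) (k := m)
    have hpp := hp.out.pos
    rw [Nat.ModEq.dvd_iff hl dvd_rfl, h2m, hmn, Nat.add_mul_mod_self_left,
      Nat.add_mul_mod_self_left, Nat.add_mul_div_left _ _ hpp, Nat.add_mul_div_left _ _ hpp,
      Nat.mod_eq_of_lt (by omega), Nat.mod_eq_of_lt (by omega), Nat.div_eq_of_lt (by omega),
      Nat.div_eq_of_lt (by omega), zero_add, zero_add, hp.out.dvd_mul, not_or]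
    refine ⟨fun h => ?_, ih n hn⟩
    have h1 : p ∣ (2 * r).factorial := by
      rw [← Nat.choose_mul_factorial_mul_factorial (show r ≤ 2 * r by omega), mul_assoc]
      exact h.mul_right _
    rw [hp.out.dvd_factorial] at h1
    omega

theorem isPrimitiveRoot_generator_pow {F : Type*} [Field F] [Fintype F] {g : Fˣ}
    (hg : ∀ x : Fˣ, x ∈ Subgroup.zpowers g) {m : ℕ} (hm : 3 * m + 1 = Fintype.card F) :
    IsPrimitiveRoot ((g : F) ^ m) 3 := by
  classical
  have hord : orderOf g = m * 3 := by
    rw [orderOf_eq_card_of_forall_mem_zpowers hg, Nat.card_eq_fintype_card, Fintype.card_units]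
    omega
  have h : IsPrimitiveRoot g (m * 3) := hord ▸ IsPrimitiveRoot.orderOf g
  have hpos : 0 < m * 3 := hord ▸ orderOf_pos g
  have := h.pow hpos rfl
  exact_mod_cast IsPrimitiveRoot.coe_units_iff.mpr this

/-- A cubic character counts cube roots. -/
theorem card_cube_roots_s14 {F R : Type*} [Field F] [DecidableEq F] [Fintype F] [CommRing R]
    [IsDomain R]
    {g : Fˣ} (hg : ∀ x : Fˣ, x ∈ Subgroup.zpowers g) (hq : Fintype.card F % 3 = 1)
    (f : F →*₀ R) (hf : f g ≠ 1) (hf3 : f g ^ 3 = 1) (u : F) :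
    (#{x : F | x ^ 3 = u} : R) = 1 + f u + f u ^ 2 := by
  have hζ := isPrimitiveRoot_generator_pow hg (m := Fintype.card F / 3) (by omega)
  have hw : 1 + f g + f g ^ 2 = 0 := by
    refine (mul_eq_zero.mp ?_).resolve_left (sub_ne_zero.mpr hf)
    linear_combination hf3
  have hunit (x : F) (hx : x ≠ 0) : f x ^ 3 = 1 := by
    obtain ⟨n, hn⟩ := Submonoid.mem_powers_iff _ _ |>.mp
      (mem_powers_iff_mem_zpowers.mpr (hg (Units.mk0 x hx)))
    have : x = (g : F) ^ n := by rw [← Units.val_pow_eq_pow_val, hn, Units.val_mk0]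
    rw [this, map_pow, pow_right_comm, hf3, one_pow]
  rcases eq_or_ne u 0 with rfl | hu
  · simp [filter_eq']
  by_cases hcube : ∃ y, y ^ 3 = u
  · have hcard : #{x : F | x ^ 3 = u} = 3 := by
      have h1 := hζ.card_nthRoots u
      rw [if_pos hcube] at h1
      rw [← Multiset.toFinset_card_of_nodup (hζ.nthRoots_nodup hu)] at h1
      refine Eq.trans (congrArg card ?_) h1
      ext x
      rw [Multiset.mem_toFinset, Polynomial.mem_nthRoots three_pos]
      simp
    obtain ⟨y, rfl⟩ := hcube
    have hy : y ≠ 0 := by rintro rfl; simp at hu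
    rw [hcard, map_pow, hunit y hy]
    norm_num
  · have hcard : #{x : F | x ^ 3 = u} = 0 := by
      rw [card_eq_zero, filter_eq_empty_iff]
      exact fun x _ hx => hcube ⟨x, hx⟩
    obtain ⟨n, hn⟩ := Submonoid.mem_powers_iff _ _ |>.mp
      (mem_powers_iff_mem_zpowers.mpr (hg (Units.mk0 u hu)))
    have hun : u = (g : F) ^ n := by rw [← Units.val_pow_eq_pow_val, hn, Units.val_mk0]
    have hfu : f u = f g ^ (n % 3) := by
      rw [hun, map_pow]
      exact pow_eq_pow_mod n hf3
    have hr : n % 3 ≠ 0 := fun h0 => hcube ⟨(g : F) ^ (n / 3), by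
      rw [hun, ← pow_mul]; congr 1; omega⟩
    rw [hcard, Nat.cast_zero, hfu]
    obtain h1 | h2 : n % 3 = 1 ∨ n % 3 = 2 := by omega
    · rw [h1]; linear_combination -hw
    · rw [h2]; linear_combination -hw - f g * hf3

theorem sum_comp_cube {F R : Type*} [Field F] [Fintype F] [DecidableEq F] [CommRing R]
    (φ : F → R) : ∑ x : F, φ (x ^ 3) = ∑ u : F, (#{x : F | x ^ 3 = u} : R) * φ u := by
  rw [← Finset.sum_fiberwise (s := univ) (g := fun x : F => x ^ 3)]
  refine sum_congr rfl fun u _ => ?_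
  rw [← nsmul_eq_mul, ← sum_const]
  exact sum_congr rfl fun x hx => by rw [(mem_filter.mp hx).2]

/-- The number of points on the affine curve `x ^ 3 = t * (1 - t)`, modulo the characteristic. -/
theorem sum_card_cube_roots_eq_choose {F : Type*} [Field F] [Fintype F] [DecidableEq F]
    {g : Fˣ} (hg : ∀ x : Fˣ, x ∈ Subgroup.zpowers g) {m : ℕ} (hm : 3 * m + 1 = Fintype.card F) :
    ((∑ t : F, #{x : F | x ^ 3 = t * (1 - t)} : ℕ) : F) = -((-1) ^ m * (2 * m).choose m) := by
  have hζ := isPrimitiveRoot_generator_pow hg hm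
  have hm0 : m ≠ 0 := by have := Fintype.one_lt_card (α := F); omega
  let f : F →*₀ F := powMonoidWithZeroHom hm0
  have hf (x : F) : f x = x ^ m := rfl
  have hpow (i : ℕ) (hi : i < 6 * m) :
      ∑ t : F, t ^ i = if i = 3 * m then -1 else 0 := by
    rcases eq_or_ne i 0 with rfl | hi0
    · rw [if_neg (by omega)]; exact FiniteField.sum_pow_lt_card_sub_one F 0 (by omega)
    have h1 : ∑ t : F, t ^ i = ∑ t : Fˣ, (t ^ i : F) := by
      rw [← Fintype.sum_subtype_add_sum_subtype (fun t : F => t ≠ 0)]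
      have h0 : ∑ t : {t : F // ¬ t ≠ 0}, (t : F) ^ i = 0 :=
        sum_eq_zero fun t _ => by rw [not_not.mp t.2, zero_pow hi0]
      rw [h0, add_zero]
      exact (Fintype.sum_equiv unitsEquivNeZero _ _ fun _ => rfl).symm
    rw [h1, FiniteField.sum_pow_units]
    have hc : Fintype.card F - 1 = 3 * m := by omega
    rw [hc]
    refine if_congr ⟨fun ⟨j, hj⟩ => ?_, fun h => h ▸ dvd_rfl⟩ rfl rfl
    obtain rfl : j = 1 := by
      have : j < 2 := by nlinarith
      have : j ≠ 0 := by rintro rfl; simp at hj; exact hi0 hj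
      omega
    rw [hj, mul_one]
  have hsum (a : ℕ) (ha : 0 < a) (ha2 : a ≤ 2 * m) : ∑ t : F, (t * (1 - t)) ^ a =
      ∑ j ∈ range (a + 1), (-1) ^ j * (a.choose j : F) * if a + j = 3 * m then -1 else 0 := by
    have hexp (t : F) : (t * (1 - t)) ^ a =
        ∑ j ∈ range (a + 1), (-1) ^ j * (a.choose j : F) * t ^ (a + j) := by
      rw [mul_pow, show 1 - t = -t + 1 by ring, add_pow, mul_sum]
      refine sum_congr rfl fun j _ => ?_
      rw [neg_pow t j]
      ring
    simp_rw [hexp]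
    rw [sum_comm]
    refine sum_congr rfl fun j hj => ?_
    rw [← mul_sum, hpow _ (by rw [mem_range] at hj; omega)]
  push_cast
  simp_rw [card_cube_roots_s14 hg (by omega) f (hf g ▸ hζ.ne_one (by norm_num))
    (hf g ▸ hζ.pow_eq_one), hf, ← pow_mul, sum_add_distrib]
  have h0 : ∑ _t : F, (1 : F) = 0 := by simp
  have h1 : ∑ t : F, (t * (1 - t)) ^ m = 0 := by
    rw [hsum m (by omega) (by omega)]
    exact sum_eq_zero fun j hj => by rw [if_neg (by rw [mem_range] at hj; omega), mul_zero]
  have h2 := hsum (m * 2) (by omega) (by omega)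
  rw [sum_eq_single m (fun j _ hj => by rw [if_neg (by omega), mul_zero])
    (fun h => absurd (mem_range.mpr (by omega)) h), if_pos (by omega)] at h2
  rw [h0, h1, h2, mul_comm m 2]
  ring

theorem card_cube_roots_mulChar {F R : Type*} [Field F] [DecidableEq F] [Fintype F] [CommRing R]
    [IsDomain R] {g : Fˣ} (hg : ∀ x : Fˣ, x ∈ Subgroup.zpowers g) (hq : Fintype.card F % 3 = 1)
    {χ : MulChar F R} (hχ : orderOf χ = 3) (u : F) :
    (#{x : F | x ^ 3 = u} : R) = 1 + χ u + χ⁻¹ u := by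
  have hχ3 : χ ^ 3 = 1 := hχ ▸ pow_orderOf_eq_one χ
  have hinv : χ⁻¹ = χ ^ 2 := inv_eq_of_mul_eq_one_right (by rw [← pow_succ', hχ3])
  rw [hinv, MulChar.pow_apply' χ two_ne_zero]
  refine card_cube_roots_s14 hg hq χ.toMonoidWithZeroHom (fun h => ?_) ?_ u
  · have h1 : χ = 1 := by
      rw [MulChar.eq_one_iff]
      intro a
      obtain ⟨n, rfl⟩ := Submonoid.mem_powers_iff _ _ |>.mp
        (mem_powers_iff_mem_zpowers.mpr (hg a))
      rw [Units.val_pow_eq_pow_val, map_pow]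
      exact (congrArg (· ^ n) h).trans (one_pow n)
    rw [h1, orderOf_one] at hχ
    omega
  · have := congrArg (fun ψ : MulChar F R => ψ g) hχ3
    rwa [MulChar.pow_apply' χ three_ne_zero, MulChar.one_apply_coe] at this

/-- The cubic equation satisfied by cubic exponential sums. -/
theorem cubic_exponential_sum_pow_three {F R : Type*} [Field F] [Fintype F] [CommRing R]
    [IsDomain R] {g : Fˣ} (hg : ∀ x : Fˣ, x ∈ Subgroup.zpowers g) (hq : Fintype.card F % 3 = 1)
    {χ : MulChar F R} (hχ : orderOf χ = 3) {ψ : AddChar F R} (hψ : ψ ≠ 1) :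
    (∑ x : F, ψ (x ^ 3)) ^ 3 = 3 * Fintype.card F * ∑ x : F, ψ (x ^ 3) +
      Fintype.card F * (jacobiSum χ χ + jacobiSum χ⁻¹ χ⁻¹) := by
  classical
  have hprim := AddChar.IsPrimitive.of_ne_one hψ
  have hχ3 : χ ^ 3 = 1 := hχ ▸ pow_orderOf_eq_one χ
  have hχ1 : χ ≠ 1 := fun h => by rw [h, orderOf_one] at hχ; omega
  have hinv : χ⁻¹ = χ ^ 2 := inv_eq_of_mul_eq_one_right (by rw [← pow_succ', hχ3])
  have hsq : χ * χ = χ⁻¹ := by rw [hinv, sq]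
  have hsq' : χ⁻¹ * χ⁻¹ = χ := by rw [← mul_inv, hsq, inv_inv]
  have hneg : χ (-1) = 1 := by
    have h1 : χ (-1) ^ 3 = 1 := by
      have := congrArg (fun ψ : MulChar F R => ψ (-1)) hχ3
      rwa [MulChar.pow_apply' χ three_ne_zero, MulChar.one_apply isUnit_one.neg] at this
    have h2 : χ (-1) ^ 2 = 1 := by rw [← map_pow]; simp
    linear_combination h1 - χ (-1) * h2
  have hmul : gaussSum χ ψ * gaussSum χ⁻¹ ψ = Fintype.card F := by
    have := gaussSum_mul_gaussSum_pow_orderOf_sub_one hχ1 hprim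
    rwa [hχ, hneg, one_mul, ← hinv] at this
  have hJ := jacobiSum_mul_nontrivial (χ := χ) (φ := χ) (by rwa [hsq, Ne, inv_eq_one]) ψ
  have hJ' := jacobiSum_mul_nontrivial (χ := χ⁻¹) (φ := χ⁻¹) (by rwa [hsq']) ψ
  rw [hsq] at hJ
  rw [hsq'] at hJ'
  have hG : ∑ x : F, ψ (x ^ 3) = gaussSum χ ψ + gaussSum χ⁻¹ ψ := by
    simp_rw [sum_comp_cube (fun x => ψ x), card_cube_roots_mulChar hg hq hχ, add_mul,
      sum_add_distrib, one_mul, AddChar.sum_eq_zero_of_ne_one hψ, zero_add, gaussSum]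
  rw [hG]
  linear_combination
    (3 * (gaussSum χ ψ + gaussSum χ⁻¹ ψ) + jacobiSum χ χ + jacobiSum χ⁻¹ χ⁻¹) * hmul
    - gaussSum χ ψ * hJ - gaussSum χ⁻¹ ψ * hJ'

theorem sum_card_cube_roots_eq_jacobiSum {F R : Type*} [Field F] [Fintype F] [DecidableEq F]
    [CommRing R] [IsDomain R] {g : Fˣ} (hg : ∀ x : Fˣ, x ∈ Subgroup.zpowers g)
    (hq : Fintype.card F % 3 = 1) {χ : MulChar F R} (hχ : orderOf χ = 3) :
    ((∑ t : F, #{x : F | x ^ 3 = t * (1 - t)} : ℕ) : R) =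
      Fintype.card F + (jacobiSum χ χ + jacobiSum χ⁻¹ χ⁻¹) := by
  push_cast
  simp_rw [card_cube_roots_mulChar hg hq hχ, map_mul, sum_add_distrib, jacobiSum]
  simp [add_assoc]

theorem exists_int_add_mul_of_mem_adjoin {R : Type*} [CommRing R] {μ z : R}
    (hμ : μ ^ 2 + μ + 1 = 0) (hz : z ∈ Algebra.adjoin ℤ {μ}) : ∃ a b : ℤ, z = a + b * μ := by
  induction hz using Algebra.adjoin_induction with
  | mem x hx => obtain rfl := hx; exact ⟨0, 1, by simp⟩
  | algebraMap r => exact ⟨r, 0, by simp⟩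
  | add x y _ _ hx hy =>
    obtain ⟨a, b, rfl⟩ := hx
    obtain ⟨a', b', rfl⟩ := hy
    exact ⟨a + a', b + b', by push_cast; ring⟩
  | mul x y _ _ hx hy =>
    obtain ⟨a, b, rfl⟩ := hx
    obtain ⟨a', b', rfl⟩ := hy
    exact ⟨a * a' - b * b', a * b' + b * a' - b * b', by
      push_cast; linear_combination (b * b' : R) * hμ⟩

theorem jacobiSum_add_jacobiSum_inv_eq {F : Type*} [Field F] [Fintype F]
    (hq : Fintype.card F % 3 = 1) {χ : MulChar F ℂ} (hχ : orderOf χ = 3) :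
    ∃ c d : ℤ, jacobiSum χ χ + jacobiSum χ⁻¹ χ⁻¹ = c ∧
      4 * (Fintype.card F : ℤ) = c ^ 2 + 27 * d ^ 2 ∧ c % 3 = 1 := by
  have hχ3 : χ ^ 3 = 1 := hχ ▸ pow_orderOf_eq_one χ
  have hχ1 : χ ≠ 1 := fun h => by rw [h, orderOf_one] at hχ; omega
  have hsq : χ * χ = χ⁻¹ := (inv_eq_of_mul_eq_one_right (by rw [← sq, ← pow_succ', hχ3])).symm
  have hroot := Complex.isPrimitiveRoot_exp 3 three_ne_zero
  set μ := Complex.exp (2 * Real.pi * Complex.I / (3 : ℕ))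
  have hμ3 : μ ^ 3 = 1 := hroot.pow_eq_one
  have hμ : μ ^ 2 + μ + 1 = 0 := by
    refine (mul_eq_zero.mp ?_).resolve_left (sub_ne_zero.mpr (hroot.ne_one (by norm_num)))
    linear_combination hμ3
  have hconj : (starRingEnd ℂ) μ = -1 - μ := by
    have h1 : (starRingEnd ℂ) μ = μ⁻¹ := by
      rw [← Complex.inv_eq_conj (hroot.norm'_eq_one three_ne_zero)]
    rw [h1, inv_eq_of_mul_eq_one_right]
    linear_combination -hμ
  obtain ⟨z, hz, hJ⟩ := exists_jacobiSum_eq_neg_one_add (F := F) (by norm_num : 2 < 3) hχ3 hχ3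
    (by omega) hroot
  obtain ⟨a, b, rfl⟩ := exists_int_add_mul_of_mem_adjoin hμ hz
  have hJ1 : jacobiSum χ χ = (3 * b - 1) + 3 * (b - a) * μ := by
    rw [hJ]
    linear_combination (a + b * μ - 3 * b : ℂ) * hμ
  have hJ2 : jacobiSum χ⁻¹ χ⁻¹ = (3 * b - 1) + 3 * (b - a) * (-1 - μ) := by
    have : χ⁻¹ = χ.ringHomComp (starRingEnd ℂ) := by
      rw [← MulChar.star_eq_inv]; rfl
    rw [this, jacobiSum_ringHomComp, hJ1]
    simp [hconj, map_ofNat]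
  have hchar : ringChar ℂ ≠ ringChar F := by
    rw [ringChar.eq_zero]
    exact (CharP.ringChar_ne_zero_of_finite F).symm
  have hnorm := jacobiSum_mul_jacobiSum_inv hchar hχ1 hχ1 (by rwa [hsq, Ne, inv_eq_one])
  refine ⟨3 * b + 3 * a - 2, b - a, ?_, ?_, by omega⟩
  · rw [hJ1, hJ2]; push_cast; ring
  · rw [hJ1, hJ2] at hnorm
    have : (4 * Fintype.card F : ℂ) = (3 * b + 3 * a - 2) ^ 2 + 27 * (b - a) ^ 2 := by
      rw [← hnorm]
      linear_combination (-36 * (b - a) ^ 2 : ℂ) * hμ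
    exact_mod_cast this

/-- The number of representations as a sum of cubes, as a sum over additive characters. -/
theorem card_mul_Ncube_sub {F : Type} [Field F] [Fintype F] [DecidableEq F] {ψ : AddChar F ℂ}
    (hψ : ψ.IsPrimitive) (s : ℕ) (hs : 0 < s) (z : F) :
    Fintype.card F * ((Ncube F s z : ℂ) - (Fintype.card F : ℂ) ^ (s - 1)) =
      ∑ a ∈ univ.erase (0 : F), ψ (-(a * z)) * (∑ x : F, ψ.mulShift a (x ^ 3)) ^ s := by
  have hcount : (Fintype.card F : ℂ) * Ncube F s z =
      ∑ a : F, ψ (-(a * z)) * (∑ x : F, ψ.mulShift a (x ^ 3)) ^ s := by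
    have h1 (a : F) : ψ (-(a * z)) * (∑ x : F, ψ.mulShift a (x ^ 3)) ^ s =
        ∑ x : Fin s → F, ψ (a * (∑ i, x i ^ 3 - z)) := by
      rw [Fintype.sum_pow, mul_sum]
      refine sum_congr rfl fun x _ => ?_
      simp_rw [AddChar.mulShift_apply]
      have hprod : ∏ i, ψ (a * x i ^ 3) = ψ (∑ i, a * x i ^ 3) :=
        (map_prod ψ.toMonoidHom (fun i => Multiplicative.ofAdd (a * x i ^ 3)) univ).symm
      rw [hprod, ← AddChar.map_add_eq_mul, ← mul_sum]
      congr 1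
      ring
    simp_rw [h1]
    rw [sum_comm]
    simp_rw [AddChar.sum_mulShift _ hψ, sub_eq_zero, Nat.cast_ite, Nat.cast_zero]
    rw [← sum_filter, sum_const, nsmul_eq_mul, Ncube, Nat.card_eq_fintype_card,
      Fintype.card_subtype, mul_comm]
  have h0 : ψ (-(0 * z)) * (∑ x : F, ψ.mulShift 0 (x ^ 3)) ^ s = (Fintype.card F : ℂ) ^ s := by
    simp
  rw [mul_sub, ← pow_succ', Nat.sub_add_cancel hs, hcount,
    ← add_sum_erase univ _ (mem_univ (0 : F)), h0, add_sub_cancel_left]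

theorem isCoprime_of_cubic_point_count {F : Type*} [Field F] [Fintype F] {p k : ℕ}
    [hp : Fact p.Prime] (hF : Fintype.card F = p ^ k) (hp3 : p % 3 = 1) {g : Fˣ}
    (hg : ∀ x : Fˣ, x ∈ Subgroup.zpowers g) {χ : MulChar F ℂ} (hχ : orderOf χ = 3) {c : ℤ}
    (hc : jacobiSum χ χ + jacobiSum χ⁻¹ χ⁻¹ = c) : IsCoprime c (p : ℤ) := by
  classical
  have hq : Fintype.card F % 3 = 1 := by rw [hF, Nat.pow_mod, hp3, one_pow, Nat.one_mod]
  have hm : 3 * (Fintype.card F / 3) + 1 = Fintype.card F := by omega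
  set m := Fintype.card F / 3
  have hchar : CharP F p := charP_of_card_eq_prime_pow hF
  have h1 := sum_card_cube_roots_eq_jacobiSum hg hq hχ
  have h2 := sum_card_cube_roots_eq_choose hg hm
  rw [hc] at h1
  have h3 : ((∑ t : F, #{x : F | x ^ 3 = t * (1 - t)} : ℕ) : ℤ) = Fintype.card F + c := by
    exact_mod_cast h1
  have h4 := congrArg (Int.cast : ℤ → F) h3
  rw [Int.cast_natCast, h2, Int.cast_add, Int.cast_natCast, Nat.cast_card_eq_zero, zero_add] at h4
  refine (Prime.coprime_iff_not_dvd (Nat.prime_iff_prime_int.mp hp.out)).mpr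
    (fun hdvd => ?_) |>.symm
  rw [(CharP.intCast_eq_zero_iff F p c).mpr hdvd, neg_eq_zero] at h4
  have h5 := (mul_eq_zero.mp h4).resolve_left (pow_ne_zero _ (neg_ne_zero.mpr one_ne_zero))
  exact not_dvd_choose_third hp3 k m (hm.trans hF) ((CharP.cast_eq_zero_iff F p _).mp h5)

theorem jacobiSum_add_jacobiSum_inv_eq_of_four_mul {F : Type*} [Field F] [Fintype F] {p k : ℕ}
    [hp : Fact p.Prime] (hk : 0 < k) (hF : Fintype.card F = p ^ k) (hq : Fintype.card F % 3 = 1)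
    {g : Fˣ} (hg : ∀ x : Fˣ, x ∈ Subgroup.zpowers g) {χ : MulChar F ℂ} (hχ : orderOf χ = 3)
    {c d : ℤ} (h4q : 4 * (p : ℤ) ^ k = c ^ 2 + 27 * d ^ 2) (hc3 : c % 3 = 1)
    (hcp : p % 3 = 1 → IsCoprime c (p : ℤ)) :
    jacobiSum χ χ + jacobiSum χ⁻¹ χ⁻¹ = c := by
  obtain ⟨c', d', hc', h4q', hc3'⟩ := jacobiSum_add_jacobiSum_inv_eq hq hχ
  rw [hF, Nat.cast_pow] at h4q'
  suffices c ^ 2 = c' ^ 2 by rw [hc', eq_of_sq_eq_sq_of_mod_three this hc3 hc3']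
  obtain h0 | h1 | h2 : p % 3 = 0 ∨ p % 3 = 1 ∨ p % 3 = 2 := by omega
  · rw [hF, Nat.pow_mod, h0, zero_pow hk.ne'] at hq
    omega
  · exact cubic_parameters_unique_of_split (by omega) k h4q h4q' (hcp h1)
      (isCoprime_of_cubic_point_count hF h1 hg hχ hc') hk
  · have hd := cubic_parameters_unique_of_inert h2 k h4q
    have hd' := cubic_parameters_unique_of_inert h2 k h4q'
    rw [hd] at h4q
    rw [hd'] at h4q'
    linarith

end

/-- For every `z ∈ F_q*` and `s ≥ 4`, with `u_s(z) = N_s(z) - q^{s-1}`, one has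
`u_s(z) = 3q·u_{s-2}(z) + qc·u_{s-3}(z)`. -/
theorem u_recurrence
    (p k q : ℕ) [Fact p.Prime] (hk : 0 < k) (hq : q = p ^ k) (hq3 : q % 3 = 1)
    (F : Type) [Field F] [Fintype F] (hF : Fintype.card F = q)
    (g : Fˣ) (hg : ∀ x : Fˣ, x ∈ Subgroup.zpowers g)
    (c d : ℤ) (h4q : 4 * (q : ℤ) = c ^ 2 + 27 * d ^ 2) (hc3 : c % 3 = 1)
    (hd : 0 ≤ d) (hcp : p % 3 = 1 → IsCoprime c (p : ℤ))
    (z : F) (hz : z ≠ 0) (s : ℕ) (hs : 4 ≤ s) :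
    (Ncube F s z : ℤ) - (q : ℤ) ^ (s - 1)
      = 3 * (q : ℤ) * ((Ncube F (s - 2) z : ℤ) - (q : ℤ) ^ (s - 3))
        + (q : ℤ) * c * ((Ncube F (s - 3) z : ℤ) - (q : ℤ) ^ (s - 4)) := by
  classical
  have hqF : Fintype.card F % 3 = 1 := by rw [hF, hq3]
  obtain ⟨χ, hχ⟩ := MulChar.exists_mulChar_orderOf F (n := 3) (by omega)
    (Complex.isPrimitiveRoot_exp 3 three_ne_zero)
  have hJ := jacobiSum_add_jacobiSum_inv_eq_of_four_mul hk (hF.trans hq) hqF hg hχ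
    (by rw [← h4q, hq, Nat.cast_pow]) hc3 hcp
  obtain ⟨ψ, hψ⟩ := AddChar.exists_apply_ne_zero.mpr (one_ne_zero (α := F))
  have hprim : ψ.IsPrimitive := AddChar.IsPrimitive.of_ne_one (AddChar.ne_one_iff.mpr ⟨1, hψ⟩)
  have hq0 : (q : ℂ) ≠ 0 := by
    rw [← hF]
    exact_mod_cast Fintype.card_ne_zero
  obtain ⟨t, rfl⟩ := Nat.exists_eq_add_of_le' hs
  have h1 := card_mul_Ncube_sub hprim (t + 4) (by omega) z
  have h2 := card_mul_Ncube_sub hprim (t + 2) (by omega) z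
  have h3 := card_mul_Ncube_sub hprim (t + 1) (by omega) z
  have hrec (a : F) (ha : a ∈ Finset.univ.erase (0 : F)) :
      ψ (-(a * z)) * (∑ x : F, ψ.mulShift a (x ^ 3)) ^ (t + 4) =
        3 * q * (ψ (-(a * z)) * (∑ x : F, ψ.mulShift a (x ^ 3)) ^ (t + 2)) +
        q * c * (ψ (-(a * z)) * (∑ x : F, ψ.mulShift a (x ^ 3)) ^ (t + 1)) := by
    have := cubic_exponential_sum_pow_three hg hqF hχ (hprim (Finset.ne_of_mem_erase ha))
    rw [hJ, hF] at this
    linear_combination (ψ (-(a * z)) * (∑ x : F, ψ.mulShift a (x ^ 3)) ^ (t + 1)) * this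
  rw [Finset.sum_congr rfl hrec, Finset.sum_add_distrib, ← Finset.mul_sum, ← Finset.mul_sum, ← h2,
    ← h3, hF] at h1
  have h4 : ((Ncube F (t + 4) z : ℂ) - (q : ℂ) ^ (t + 3)) =
      3 * (q : ℂ) * ((Ncube F (t + 2) z : ℂ) - (q : ℂ) ^ (t + 1)) +
        (q : ℂ) * c * ((Ncube F (t + 1) z : ℂ) - (q : ℂ) ^ t) := by
    refine mul_left_cancel₀ hq0 (h1.trans ?_)
    simp only [Nat.add_sub_cancel, show t + 2 - 1 = t + 1 from rfl]
    ring
  exact_mod_cast h4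
end
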